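/- There exists an absolute constant C > 0 such that for every integer k ≥ 2 and every s ∈ ℂ with |s| ≤ √k, one has | Γ(s+k)/Γ(k) − k^s | ≤ C · k^{Re(s)} · (1 + |s|²)/k, where k^s = exp(s·log k) with the real logarithm of the positive integer k, and Γ is the complex Gamma function. -/

import Mathlib

open Filter Topology Finset in
/-- The ratio of Euler's approximations of `Γ(s + k)` and `Γ(k)`. -/
lemma GammaSeq_add_div_GammaSeq {s k : ℂ} {N : ℕ} (hN : N ≠ 0)
    (hk : ∀ j : ℕ, k + j ≠ 0) :
    Complex.GammaSeq (s + k) N / Complex.GammaSeq k N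
      = Complex.exp (s * (Real.log N : ℂ)) * ∏ j ∈ range (N + 1), (1 + s / (k + j))⁻¹ := by
  have hN' : (N : ℂ) ≠ 0 := Nat.cast_ne_zero.mpr hN
  have hprod : ∏ j ∈ range (N + 1), (1 + s / (k + j))⁻¹
      = (∏ j ∈ range (N + 1), (k + j)) / ∏ j ∈ range (N + 1), (s + k + j) := by
    rw [← prod_div_distrib]
    refine prod_congr rfl fun j _ => ?_
    rw [one_add_div (hk j), inv_div]
    ring_nf
  have hP : ∏ j ∈ range (N + 1), (k + j) ≠ 0 := prod_ne_zero_iff.mpr fun j _ => hk j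
  have hfac : (N.factorial : ℂ) ≠ 0 := Nat.cast_ne_zero.mpr N.factorial_ne_zero
  have hpow : (N : ℂ) ^ k ≠ 0 := by simp [Complex.cpow_eq_zero_iff, hN']
  have hexp : Complex.exp (s * (Real.log N : ℂ)) = (N : ℂ) ^ s := by
    rw [Complex.cpow_def_of_ne_zero hN', Complex.natCast_log, mul_comm]
  rw [Complex.GammaSeq, Complex.GammaSeq, hprod, hexp, Complex.cpow_add _ _ hN']
  field_simp

open Finset in
lemma sum_inv_add_sq_le {k : ℕ} (hk : 2 ≤ k) (n : ℕ) :
    ∑ j ∈ range n, 1 / ((k : ℝ) + j) ^ 2 ≤ 2 / (k : ℝ) := by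
  have hk' : (2 : ℝ) ≤ k := by exact_mod_cast hk
  have telescope : ∑ j ∈ range n, 1 / ((k : ℝ) + j) ^ 2
      ≤ 1 / ((k : ℝ) - 1) - 1 / (k + n - 1) := by
    induction n with
    | zero => simp
    | succ n ih =>
      have hn : (0 : ℝ) ≤ n := n.cast_nonneg
      have hstep : 1 / ((k : ℝ) + n) ^ 2 ≤ 1 / (k + n - 1) - 1 / (k + n) := by
        have h1 : (0 : ℝ) < k + n - 1 := by linarith
        rw [div_sub_div _ _ (by linarith) (by linarith), div_le_div_iff₀ (by positivity)
          (by positivity)]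
        nlinarith
      rw [sum_range_succ]
      have hcast : (k : ℝ) + (n + 1 : ℕ) - 1 = k + n := by push_cast; ring
      rw [hcast]
      linarith
  have hlast : 0 ≤ 1 / ((k : ℝ) + n - 1) :=
    one_div_nonneg.mpr (by linarith [n.cast_nonneg (α := ℝ)])
  have hfirst : 1 / ((k : ℝ) - 1) ≤ 2 / k := by
    rw [div_le_div_iff₀ (by linarith) (by linarith)]
    linarith
  linarith

/-- The logarithm of the `n`-th factor in Euler's product for the Gamma function. -/
noncomputable def eulerLogFactor (s : ℂ) (n : ℝ) : ℂ :=
  s * (Real.log (1 + 1 / n) : ℂ) - Complex.log (1 + s / n)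

lemma norm_eulerLogFactor_le {s : ℂ} {n : ℝ} (hn : 2 ≤ n) (hs : ‖s‖ ≤ 3 / 4 * n) :
    ‖eulerLogFactor s n‖ ≤ 3 * (1 + ‖s‖ ^ 2) * (1 / n ^ 2) := by
  have hn0 : 0 < n := by linarith
  have hz : ‖s / (n : ℂ)‖ = ‖s‖ / n := by simp [abs_of_pos hn0]
  have hz34 : ‖s / (n : ℂ)‖ ≤ 3 / 4 := by rwa [hz, div_le_iff₀ hn0]
  have hw : ‖((1 / n : ℝ) : ℂ)‖ = 1 / n := by
    rw [Complex.norm_real, Real.norm_of_nonneg (by positivity)]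
  have hw2 : 1 / n ≤ 1 / 2 := by gcongr
  have h1 := Complex.norm_log_one_add_sub_self_le (z := s / (n : ℂ)) (by linarith)
  have h2 := Complex.norm_log_one_add_sub_self_le (z := ((1 / n : ℝ) : ℂ)) (by rw [hw]; linarith)
  have h1' : ‖Complex.log (1 + s / n) - s / n‖ ≤ 2 * (‖s‖ ^ 2 / n ^ 2) := by
    have hinv : (1 - ‖s / (n : ℂ)‖)⁻¹ ≤ 4 := by
      rw [inv_le_comm₀ (by linarith) (by norm_num)]
      linarith
    calc _ ≤ _ := h1
      _ ≤ ‖s / (n : ℂ)‖ ^ 2 * 4 / 2 := by gcongr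
      _ = _ := by rw [hz]; ring
  have h2' : ‖(Real.log (1 + 1 / n) : ℂ) - (1 / n : ℝ)‖ ≤ 1 / n ^ 2 := by
    have hlog : (Real.log (1 + 1 / n) : ℂ) = Complex.log (1 + ((1 / n : ℝ) : ℂ)) := by
      rw [Complex.ofReal_log (by positivity)]
      push_cast
      rfl
    have hinv : (1 - ‖((1 / n : ℝ) : ℂ)‖)⁻¹ ≤ 2 := by
      rw [hw, inv_le_comm₀ (by linarith) (by norm_num)]
      linarith
    rw [hlog]
    calc _ ≤ _ := h2
      _ ≤ ‖((1 / n : ℝ) : ℂ)‖ ^ 2 * 2 / 2 := by gcongr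
      _ = _ := by rw [hw]; ring
  have hsplit : eulerLogFactor s n
      = s * ((Real.log (1 + 1 / n) : ℂ) - (1 / n : ℝ)) - (Complex.log (1 + s / n) - s / n) := by
    rw [eulerLogFactor]
    push_cast
    ring
  calc ‖eulerLogFactor s n‖
      ≤ ‖s‖ * (1 / n ^ 2) + 2 * (‖s‖ ^ 2 / n ^ 2) := by
        rw [hsplit]
        refine (norm_sub_le _ _).trans ?_
        rw [norm_mul]
        gcongr
    _ = (‖s‖ + 2 * ‖s‖ ^ 2) * (1 / n ^ 2) := by ring
    _ ≤ 3 * (1 + ‖s‖ ^ 2) * (1 / n ^ 2) := by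
        gcongr
        nlinarith [sq_nonneg (‖s‖ - 1)]

open Finset in
lemma exp_sum_eulerLogFactor (s : ℂ) {k : ℝ} (hk : 0 < k)
    (hs : ∀ j : ℕ, 1 + s / ((k : ℂ) + j) ≠ 0) (n : ℕ) :
    Complex.exp (∑ j ∈ range n, eulerLogFactor s (k + j))
      = Complex.exp (s * ((Real.log (k + n) : ℂ) - (Real.log k : ℂ)))
        * ∏ j ∈ range n, (1 + s / ((k : ℂ) + j))⁻¹ := by
  induction n with
  | zero => simp
  | succ n ih =>
    have hlog : Real.log (1 + 1 / (k + n)) = Real.log (k + (n + 1 : ℕ)) - Real.log (k + n) := by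
      rw [← Real.log_div (by positivity) (by positivity)]
      congr 1
      push_cast
      field_simp
      ring
    have hfactor : Complex.exp (eulerLogFactor s (k + n))
        = Complex.exp (s * ((Real.log (k + (n + 1 : ℕ)) : ℂ) - (Real.log (k + n) : ℂ)))
          * (1 + s / ((k : ℂ) + n))⁻¹ := by
      rw [eulerLogFactor, hlog, Complex.exp_sub]
      push_cast
      rw [Complex.exp_log (hs n), div_eq_mul_inv]
    rw [sum_range_succ, prod_range_succ, Complex.exp_add, ih, hfactor, mul_mul_mul_comm,
      ← Complex.exp_add, ← mul_assoc, ← mul_assoc]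
    congr 3
    ring_nf

open Filter Topology in
lemma tendsto_log_add_sub_log (a : ℝ) :
    Tendsto (fun N : ℕ => Real.log (N + a) - Real.log N) atTop (𝓝 0) := by
  have h0 : Tendsto (fun N : ℕ => 1 + a / (N : ℝ)) atTop (𝓝 1) := by
    simpa using (tendsto_const_div_atTop_nhds_zero_nat a).const_add 1
  have h := h0.log one_ne_zero
  rw [Real.log_one] at h
  refine h.congr' ?_
  filter_upwards [eventually_ne_atTop 0, h0.eventually_ne one_ne_zero] with N hN hN1
  have hN' : (N : ℝ) ≠ 0 := Nat.cast_ne_zero.mpr hN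
  have hmul : (N : ℝ) + a = N * (1 + a / N) := by field_simp
  rw [hmul, Real.log_mul hN' hN1]
  ring

open Filter Topology Finset in
lemma tendsto_exp_sum_eulerLogFactor (s : ℂ) {k : ℝ} (hk : 0 < k) (hs : 0 < (s + k).re) :
    Tendsto (fun N : ℕ => Complex.exp (∑ j ∈ range (N + 1), eulerLogFactor s (k + j))) atTop
      (𝓝 (Complex.Gamma (s + k) / Complex.Gamma k * Complex.exp (-(s * (Real.log k : ℂ))))) := by
  have hkj : ∀ j : ℕ, (k : ℂ) + j ≠ 0 := fun j => by
    have : (k + j : ℝ) ≠ 0 := by positivity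
    exact_mod_cast this
  have hsj : ∀ j : ℕ, 1 + s / ((k : ℂ) + j) ≠ 0 := fun j => by
    rw [one_add_div (hkj j)]
    refine div_ne_zero (fun h => ?_) (hkj j)
    have hre := congrArg Complex.re h
    simp only [Complex.add_re, Complex.ofReal_re, Complex.natCast_re, Complex.zero_re] at hre hs
    linarith [j.cast_nonneg (α := ℝ)]
  have hquot := (Complex.GammaSeq_tendsto_Gamma (s + k)).div (Complex.GammaSeq_tendsto_Gamma k)
    (Complex.Gamma_ne_zero_of_re_pos (by simpa using hk))
  have hcorr : Tendsto (fun N : ℕ =>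
      Complex.exp (s * ((Real.log (N + (k + 1)) - Real.log N : ℝ) : ℂ))) atTop (𝓝 1) := by
    have h := ((Complex.continuous_ofReal.tendsto 0).comp
      (tendsto_log_add_sub_log (k + 1))).const_mul s
    simpa using h.cexp
  have hlim := (hquot.mul_const (Complex.exp (-(s * (Real.log k : ℂ))))).mul hcorr
  rw [mul_one] at hlim
  refine hlim.congr' ?_
  filter_upwards [eventually_ne_atTop 0] with N hN
  have hcast : (N : ℝ) + (k + 1) = k + (N + 1 : ℕ) := by push_cast; ring
  rw [exp_sum_eulerLogFactor s hk hsj, Pi.div_apply, GammaSeq_add_div_GammaSeq hN hkj, hcast,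
    mul_right_comm _ (∏ j ∈ range (N + 1), _), ← Complex.exp_add, mul_right_comm,
    ← Complex.exp_add]
  congr 2
  push_cast
  ring

theorem statement6 :
    ∃ C : ℝ, 0 < C ∧
      ∀ k : ℕ, 2 ≤ k → ∀ s : ℂ, ‖s‖ ≤ Real.sqrt k →
        ‖Complex.Gamma (s + (k : ℂ)) / Complex.Gamma (k : ℂ)
            - Complex.exp (s * (Real.log k : ℂ))‖
          ≤ C * (k : ℝ) ^ s.re * (1 + ‖s‖ ^ 2) / k := by
  refine ⟨6 * Real.exp 9, by positivity, fun k hk s hs => ?_⟩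
  have hk2 : (2 : ℝ) ≤ k := by exact_mod_cast hk
  have hk0 : (0 : ℝ) < k := by linarith
  have hsqrt : Real.sqrt k ≤ 3 / 4 * k := by
    rw [Real.sqrt_le_left (by positivity)]
    nlinarith
  have hs2 : ‖s‖ ^ 2 ≤ k := by
    rw [← Real.sq_sqrt hk0.le]
    gcongr
  have hre : 0 < (s + ((k : ℝ) : ℂ)).re := by
    have h := (abs_le.mp (Complex.abs_re_le_norm s)).1
    simp only [Complex.add_re, Complex.ofReal_re]
    linarith
  set W : ℕ → ℂ := fun N => ∑ j ∈ Finset.range (N + 1), eulerLogFactor s (k + j)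
  have hWle (N : ℕ) : ‖W N‖ ≤ 6 * (1 + ‖s‖ ^ 2) / k := by
    calc ‖W N‖ ≤ ∑ j ∈ Finset.range (N + 1), 3 * (1 + ‖s‖ ^ 2) * (1 / ((k : ℝ) + j) ^ 2) := by
          refine norm_sum_le_of_le _ fun j _ => norm_eulerLogFactor_le ?_ ?_ <;>
            linarith [j.cast_nonneg (α := ℝ)]
      _ ≤ 3 * (1 + ‖s‖ ^ 2) * (2 / k) := by
          rw [← Finset.mul_sum]
          gcongr
          exact sum_inv_add_sq_le hk _
      _ = _ := by ring
  have hbound : 6 * (1 + ‖s‖ ^ 2) / (k : ℝ) ≤ 9 := by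
    rw [div_le_iff₀ hk0]
    linarith
  have hexp (N : ℕ) : ‖Complex.exp (W N) - 1‖ ≤ 6 * (1 + ‖s‖ ^ 2) / k * Real.exp 9 := by
    have h := Complex.norm_exp_sub_sum_le_norm_mul_exp (W N) 1
    simp only [Finset.sum_range_one, pow_zero, Nat.factorial_zero, Nat.cast_one, div_one,
      pow_one] at h
    refine h.trans ?_
    gcongr
    · exact hWle N
    · exact (hWle N).trans hbound
  have hlim := le_of_tendsto' ((tendsto_exp_sum_eulerLogFactor s hk0 hre).sub_const 1).norm hexp
  have hnorm : ‖Complex.exp (s * (Real.log k : ℂ))‖ = (k : ℝ) ^ s.re := by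
    rw [Complex.norm_exp, Complex.re_mul_ofReal, Real.rpow_def_of_pos hk0, mul_comm]
  have hfactor : Complex.Gamma (s + k) / Complex.Gamma k - Complex.exp (s * (Real.log k : ℂ))
      = Complex.exp (s * (Real.log k : ℂ)) * (Complex.Gamma (s + (k : ℝ)) /
        Complex.Gamma (k : ℝ) * Complex.exp (-(s * (Real.log k : ℂ))) - 1) := by
    have hne := Complex.exp_ne_zero (s * (Real.log k : ℂ))
    rw [Complex.exp_neg, Complex.ofReal_natCast, mul_sub, mul_one, mul_left_comm,
      mul_inv_cancel₀ hne, mul_one]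
  rw [hfactor, norm_mul, hnorm]
  calc _ ≤ (k : ℝ) ^ s.re * (6 * (1 + ‖s‖ ^ 2) / k * Real.exp 9) := by gcongr
    _ = _ := by ring
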